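/- arXiv:1510.00531 — 2 statements merged into one kernel-verified Lean document; each statement's English description precedes it below -/
import Mathlib

section
/- Fix an integer d ≥ 2 and reals b > 0 and ν < 0. For a > 0 set A = a b^d/d, Z_a = Σ_{k∈ℕ₀^d} (A^{k₁+⋯+k_d}/(k₁!⋯k_d!))·exp(ν·k₁⋯k_d) (a convergent series), and π_a(k) = (A^{k₁+⋯+k_d}/(k₁!⋯k_d!))·exp(ν·k₁⋯k_d)/Z_a for k ∈ ℕ₀^d. Then lim_{a→∞} Σ_{k∈ℕ₀^d, k_i ≥ 1 for all i} π_a(k) = 0. -/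
open Filter

lemma aux_hasSum (n : ℕ) (x : Fin n → ℝ) (hx : ∀ i, 0 ≤ x i) :
    HasSum (fun k : Fin n → ℕ => ∏ i, (x i ^ k i / (Nat.factorial (k i) : ℝ)))
      (Real.exp (∑ i, x i)) := by
  induction n with
  | zero =>
    have := hasSum_unique (fun k : Fin 0 → ℕ => ∏ i, (x i ^ k i / (Nat.factorial (k i) : ℝ)))
    simpa using this
  | succ n ih =>
    have h1 : HasSum (fun j : ℕ => x 0 ^ j / (Nat.factorial j : ℝ)) (Real.exp (x 0)) := by
      rw [Real.exp_eq_exp_ℝ]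
      exact NormedSpace.expSeries_div_hasSum_exp (x 0)
    have h2 := ih (fun i => x i.succ) (fun i => hx _)
    have hs : Summable (fun p : ℕ × (Fin n → ℕ) => (x 0 ^ p.1 / (Nat.factorial p.1 : ℝ)) *
        ∏ i, (x (Fin.succ i) ^ p.2 i / (Nat.factorial (p.2 i) : ℝ))) := by
      apply Summable.mul_of_nonneg h1.summable h2.summable
      · intro j
        have := hx 0
        simp only [Pi.zero_apply]
        positivity
      · intro k
        exact Finset.prod_nonneg fun i _ => div_nonneg (pow_nonneg (hx _) _) (by positivity)
    have h3 := h1.mul h2 hs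
    rw [Fin.sum_univ_succ, Real.exp_add]
    rw [← (Fin.consEquiv (fun _ : Fin (n+1) => ℕ)).hasSum_iff]
    refine Eq.mpr (congrArg (fun f => HasSum f _) ?_) h3
    funext p
    simp [Fin.prod_univ_succ, Fin.consEquiv, mul_div_mul_comm]

lemma aux_two (m : ℕ) (A s t : ℝ) (hA : 0 ≤ A) (hs : 0 ≤ s) (ht : 0 ≤ t) :
    HasSum (fun k : Fin (m+2) → ℕ =>
      (A ^ (∑ i, k i) / ∏ i, (Nat.factorial (k i) : ℝ)) * (s ^ k 0 * t ^ k 1))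
      (Real.exp (A * (s + t + m))) := by
  have := aux_hasSum (m+2) (Fin.cons (A * s) (Fin.cons (A * t) (fun _ => A))) (by
    intro i
    refine Fin.cases ?_ (fun i => ?_) i
    · simpa using mul_nonneg hA hs
    · refine Fin.cases ?_ (fun i => ?_) i
      · simpa using mul_nonneg hA ht
      · simpa using hA)
  convert this using 1
  · funext k
    rw [Finset.prod_div_distrib, ← Finset.prod_pow_eq_pow_sum]
    simp only [Fin.prod_univ_succ, Fin.cons_zero, Fin.cons_succ, mul_pow]
    simp only [Fin.succ_zero_eq_one]
    ring
  · simp [Fin.sum_univ_succ]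
    ring

lemma aux_main (m : ℕ) (ν θ ε A : ℝ) (hν : ν < 0) (hθ : 0 < θ) (hθ1 : θ < 1) (hε : 0 < ε)
    (hA : 0 < A) (k : Fin (m+2) → ℕ) (hk : ∀ i, 1 ≤ k i) :
    Real.exp (ν * ∏ i, (k i : ℝ)) ≤
      Real.exp (-(Real.log θ) * (ε * A)) * (θ ^ k 0 * Real.exp ν ^ k 1)
      + Real.exp (-(Real.log θ) * (ε * A)) * (Real.exp ν ^ k 0 * θ ^ k 1)
      + Real.exp (ν * (ε * A) ^ 2) * (1 ^ k 0 * 1 ^ k 1) := by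
  have h0 : (1:ℝ) ≤ k 0 := by exact_mod_cast hk 0
  have h1 : (1:ℝ) ≤ k 1 := by exact_mod_cast hk 1
  have hp : (k 0 : ℝ) * k 1 ≤ ∏ i, (k i : ℝ) := by
    rw [Fin.prod_univ_succ, Fin.prod_univ_succ, ← mul_assoc]
    have : (1:ℝ) ≤ ∏ i : Fin m, (k i.succ.succ : ℝ) := by
      have : 1 ≤ ∏ i : Fin m, (k i.succ.succ) :=
        Nat.one_le_iff_ne_zero.mpr (Finset.prod_ne_zero_iff.mpr fun i _ => by
          have := hk i.succ.succ; omega)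
      exact_mod_cast this
    simpa using le_mul_of_one_le_right (by positivity : (0:ℝ) ≤ k 0 * k 1) this
  have hL : Real.log θ < 0 := Real.log_neg hθ hθ1
  have hpow : ∀ j : ℕ, θ ^ j = Real.exp (Real.log θ * j) := by
    intro j
    rw [mul_comm, Real.exp_nat_mul, Real.exp_log hθ]
  have hq : ∀ j : ℕ, Real.exp ν ^ j = Real.exp (ν * j) := by
    intro j
    rw [mul_comm, Real.exp_nat_mul]
  simp only [hpow, hq, ← Real.exp_add, one_pow, mul_one]
  rcases le_total (k 0 : ℝ) (ε * A) with h | h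
  · refine le_trans (Real.exp_le_exp.mpr ?_) (le_trans (le_add_of_nonneg_right (by positivity))
      (le_add_of_nonneg_right (by positivity)))
    have : (k 1 : ℝ) ≤ ∏ i, (k i : ℝ) := by nlinarith
    nlinarith
  rcases le_total (k 1 : ℝ) (ε * A) with h' | h'
  · refine le_trans (Real.exp_le_exp.mpr ?_) (le_trans (le_add_of_nonneg_left (by positivity))
      (le_add_of_nonneg_right (by positivity)))
    have : (k 0 : ℝ) ≤ ∏ i, (k i : ℝ) := by nlinarith
    nlinarith
  · refine le_trans (Real.exp_le_exp.mpr ?_) (le_add_of_nonneg_left (by positivity))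
    have : (ε * A) ^ 2 ≤ (k 0 : ℝ) * k 1 := by
      rw [sq]
      exact mul_le_mul h h' (by positivity) (by positivity)
    nlinarith

lemma aux_summable (m : ℕ) (A ν : ℝ) (hA : 0 < A) (hν : ν < 0) :
    Summable fun k : Fin (m+2) → ℕ =>
      (A ^ (∑ i, k i) / ∏ i, (Nat.factorial (k i) : ℝ)) * Real.exp (ν * ∏ i, (k i : ℝ)) := by
  refine Summable.of_nonneg_of_le (fun k => by positivity) (fun k => ?_)
    (aux_two m A 1 1 hA.le zero_le_one zero_le_one).summable
  refine mul_le_mul_of_nonneg_left ?_ (by positivity)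
  simp only [one_pow, mul_one]
  rw [Real.exp_le_one_iff]
  exact mul_nonpos_of_nonpos_of_nonneg hν.le (by positivity)

lemma aux_Z (m : ℕ) (A ν : ℝ) (hA : 0 < A) (hν : ν < 0) :
    Real.exp (A * (m + 1)) ≤ ∑' k : Fin (m+2) → ℕ,
      (A ^ (∑ i, k i) / ∏ i, (Nat.factorial (k i) : ℝ)) * Real.exp (ν * ∏ i, (k i : ℝ)) := by
  have h := aux_two m A 0 1 hA.le le_rfl zero_le_one
  have e : A * (m + 1) = A * (0 + 1 + m) := by ring
  rw [e, ← h.tsum_eq]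
  refine h.summable.tsum_le_tsum (fun k => ?_) (aux_summable m A ν hA hν)
  refine mul_le_mul_of_nonneg_left ?_ (by positivity)
  by_cases hk : k 0 = 0
  · have : ∏ i, (k i : ℝ) = 0 := Finset.prod_eq_zero (Finset.mem_univ 0) (by simp [hk])
    simp [this, hk]
  · simp [hk]
    positivity

lemma aux_N (m : ℕ) (ν θ ε A : ℝ) (hν : ν < 0) (hθ : 0 < θ) (hθ1 : θ < 1) (hε : 0 < ε)
    (hA : 0 < A) :
    ∑' k : {k : Fin (m+2) → ℕ // ∀ i, 1 ≤ k i},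
      (A ^ (∑ i, k.1 i) / ∏ i, (Nat.factorial (k.1 i) : ℝ)) * Real.exp (ν * ∏ i, (k.1 i : ℝ))
    ≤ Real.exp (-(Real.log θ) * (ε * A)) * Real.exp (A * (θ + Real.exp ν + m))
      + Real.exp (-(Real.log θ) * (ε * A)) * Real.exp (A * (Real.exp ν + θ + m))
      + Real.exp (ν * (ε * A) ^ 2) * Real.exp (A * (1 + 1 + m)) := by
  have H := (((aux_two m A θ (Real.exp ν) hA.le hθ.le (Real.exp_pos _).le).mul_left
      (Real.exp (-(Real.log θ) * (ε * A)))).add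
    ((aux_two m A (Real.exp ν) θ hA.le (Real.exp_pos _).le hθ.le).mul_left
      (Real.exp (-(Real.log θ) * (ε * A))))).add
    ((aux_two m A 1 1 hA.le zero_le_one zero_le_one).mul_left (Real.exp (ν * (ε * A) ^ 2)))
  rw [← H.tsum_eq]
  refine le_trans (Summable.tsum_le_tsum (fun k => ?_)
    ((aux_summable m A ν hA hν).subtype _) (H.summable.subtype {k | ∀ i, 1 ≤ k i}))
    (Summable.tsum_subtype_le _ {k : Fin (m+2) → ℕ | ∀ i, 1 ≤ k i} (fun k => by positivity) H.summable)
  have := mul_le_mul_of_nonneg_left (aux_main m ν θ ε A hν hθ hθ1 hε hA k.1 k.2)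
    (by positivity : 0 ≤ A ^ (∑ i, k.1 i) / ∏ i, (Nat.factorial (k.1 i) : ℝ))
  refine this.trans (le_of_eq ?_)
  simp only [Function.comp]
  ring

lemma aux_lim (m : ℕ) (ν : ℝ) (hν : ν < 0) :
    Tendsto (fun A : ℝ => (∑' k : {k : Fin (m+2) → ℕ // ∀ i, 1 ≤ k i},
      (A ^ (∑ i, k.1 i) / ∏ i, (Nat.factorial (k.1 i) : ℝ)) * Real.exp (ν * ∏ i, (k.1 i : ℝ))) /
      ∑' k : Fin (m+2) → ℕ,
      (A ^ (∑ i, k i) / ∏ i, (Nat.factorial (k i) : ℝ)) * Real.exp (ν * ∏ i, (k i : ℝ)))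
      atTop (nhds 0) := by
  have hq : Real.exp ν < 1 := by simpa using hν
  have hq0 := Real.exp_pos ν
  obtain ⟨θ, hθd⟩ : ∃ θ, θ = (1 - Real.exp ν) / 2 := ⟨_, rfl⟩
  have hθ : 0 < θ := by linarith
  have hθ1 : θ < 1 := by linarith
  have hL : Real.log θ < 0 := Real.log_neg hθ hθ1
  obtain ⟨δ, hδ⟩ : ∃ δ, δ = (1 - Real.exp ν) / 4 := ⟨_, rfl⟩
  have hδ0 : 0 < δ := by linarith
  obtain ⟨ε, hεd⟩ : ∃ ε, ε = δ / (-Real.log θ) := ⟨_, rfl⟩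
  have hε : 0 < ε := by rw [hεd]; exact div_pos hδ0 (by linarith)
  have hεL : -(Real.log θ) * ε = δ := by rw [hεd]; have := hL.ne; field_simp
  have hlim : Tendsto (fun A : ℝ => Real.exp (-(δ * A)) + Real.exp (-(δ * A))
      + Real.exp (A * (1 + ν * ε ^ 2 * A))) atTop (nhds 0) := by
    have t1 : Tendsto (fun A : ℝ => Real.exp (-(δ * A))) atTop (nhds 0) :=
      Real.tendsto_exp_neg_atTop_nhds_zero.comp (tendsto_id.const_mul_atTop hδ0)
    have hc : ν * ε ^ 2 < 0 := mul_neg_of_neg_of_pos hν (by positivity)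
    have t2 : Tendsto (fun A : ℝ => Real.exp (A * (1 + ν * ε ^ 2 * A))) atTop (nhds 0) := by
      refine Real.tendsto_exp_atBot.comp ?_
      exact tendsto_id.atTop_mul_atBot₀
        (tendsto_atBot_add_const_left _ _ (tendsto_id.const_mul_atTop_of_neg hc))
    simpa using (t1.add t1).add t2
  refine squeeze_zero' ?_ ?_ hlim
  · filter_upwards [eventually_gt_atTop 0] with A hA
    exact div_nonneg (tsum_nonneg fun k => by positivity) (tsum_nonneg fun k => by positivity)
  · filter_upwards [eventually_gt_atTop 0] with A hA
    have hN := aux_N m ν θ ε A hν hθ hθ1 hε hA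
    have hZ := aux_Z m A ν hA hν
    rw [div_le_iff₀ (lt_of_lt_of_le (Real.exp_pos _) hZ)]
    refine hN.trans (le_trans (le_of_eq ?_) (mul_le_mul_of_nonneg_left hZ (by positivity)))
    simp only [add_mul, ← Real.exp_add]
    rw [← mul_assoc, hεL]
    congr 1
    · congr 2
      · rw [hθd, hδ]; ring
      · rw [hθd, hδ]; ring
    · congr 1
      ring


/-- **Proposition 2.** Asymptotically the orientation-count distribution of the
full-dimensional Gibbs facet submodel concentrates on the set where at least
one coordinate vanishes. -/
theorem stmt1 (d : ℕ) (hd : 2 ≤ d) (b ν : ℝ) (hb : 0 < b) (hν : ν < 0)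
    (Z : ℝ → ℝ)
    (hZ : ∀ a, Z a = ∑' k : Fin d → ℕ,
      ((a * b ^ d / d) ^ (∑ i, k i) / ∏ i, (Nat.factorial (k i) : ℝ))
        * Real.exp (ν * ∏ i, (k i : ℝ)))
    (π : ℝ → (Fin d → ℕ) → ℝ)
    (hπ : ∀ a k, π a k
      = ((a * b ^ d / d) ^ (∑ i, k i) / ∏ i, (Nat.factorial (k i) : ℝ))
          * Real.exp (ν * ∏ i, (k i : ℝ)) / Z a) :
    (∀ a > 0, Summable fun k : Fin d → ℕ =>
      ((a * b ^ d / d) ^ (∑ i, k i) / ∏ i, (Nat.factorial (k i) : ℝ))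
        * Real.exp (ν * ∏ i, (k i : ℝ))) ∧
    Tendsto (fun a : ℝ => ∑' k : {k : Fin d → ℕ // ∀ i, 1 ≤ k i}, π a k)
      atTop (nhds 0) := by
  obtain ⟨m, rfl⟩ : ∃ m, d = m + 2 := ⟨d - 2, by omega⟩
  have hc : 0 < b ^ (m+2) / ((m+2 : ℕ) : ℝ) := by positivity
  refine ⟨fun a ha => aux_summable m _ ν (by positivity) hν, ?_⟩
  have hT : Tendsto (fun a : ℝ => a * b ^ (m+2) / ((m+2 : ℕ) : ℝ)) atTop atTop := by
    simp only [mul_div_assoc]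
    exact tendsto_id.atTop_mul_const hc
  refine ((aux_lim m ν hν).comp hT).congr fun a => ?_
  simp only [hπ, hZ, Function.comp]
  rw [tsum_div_const]
end

section
/- Fix integers 2 ≤ c ≤ d, s ≥ c and 0 ≤ q ≤ c, and reals Q > 0 and ν < 0. Then there exist reals R > 0 and S > 0 such that for all a > 0: |B(c,Q,a,q,s) − C(s−q, s−c+1)| < R·e^{−S·a}, where C(n,k) denotes the binomial coefficient (equal to 0 when k > n). -/
/-- `A(c,q,s,n) = Σ_F ∏_{j∈F} n_j` over subsets `F ⊆ {1,…,s}` with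
`c−q ≤ |F| ≤ c` and `|F ∪ {1,…,q}| ≥ c`. -/
def Afun (c q s : ℕ) (n : Fin s → ℕ) : ℕ :=
  ∑ F ∈ Finset.univ.powerset.filter
      (fun F : Finset (Fin s) => c - q ≤ F.card ∧ F.card ≤ c ∧
        c ≤ (F ∪ Finset.univ.filter fun j : Fin s => (j : ℕ) < q).card),
    ∏ j ∈ F, n j

/-- `B(c,Q,a,q,s)`, cf. (bck). -/
noncomputable def Bfun (d c : ℕ) (ν Q a : ℝ) (q s : ℕ) : ℝ :=
  ∑' n : Fin s → ℕ,
    (a ^ (∑ i, n i) / ∏ i, (Nat.factorial (n i) : ℝ))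
      * Real.exp (ν * Q ^ (d - c) * (Afun c q s n : ℝ) - a * (c - 1))


theorem hasSum_pi_prod (s : ℕ) (f : Fin s → ℕ → ℝ) (v : Fin s → ℝ)
    (hf0 : ∀ j n, 0 ≤ f j n) (hf : ∀ j, HasSum (f j) (v j)) :
    HasSum (fun n : Fin s → ℕ => ∏ j, f j (n j)) (∏ j, v j) := by
  induction s with
  | zero => simpa using hasSum_unique (fun n : Fin 0 → ℕ => ∏ j, f j (n j))
  | succ s ih =>
    have h1 := ih (fun j => f j.succ) (fun j => v j.succ) (fun j n => hf0 _ _) (fun j => hf _)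
    have hs := Summable.mul_of_nonneg (hf 0).summable h1.summable (fun n => hf0 0 n)
      (fun n => Finset.prod_nonneg fun j _ => hf0 _ _)
    have h2 := (hf 0).mul h1 hs
    rw [Fin.prod_univ_succ]
    rw [← (Fin.consEquiv (fun _ : Fin (s+1) => ℕ)).hasSum_iff]
    refine h2.congr_fun ?_ 
    intro x
    simp [Fin.prod_univ_succ, Fin.consEquiv]

def Iset (q s : ℕ) : Finset (Fin s) := Finset.univ.filter fun j : Fin s => (j : ℕ) < q

def supp {s : ℕ} (n : Fin s → ℕ) : Finset (Fin s) := Finset.univ.filter fun j => n j ≠ 0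

theorem Afun_ge (c q s : ℕ) (n : Fin s → ℕ) (F : Finset (Fin s)) (h2 : F.card ≤ c)
    (h3 : c ≤ (F ∪ Iset q s).card) : ∏ j ∈ F, n j ≤ Afun c q s n := by
  unfold Afun
  refine Finset.single_le_sum (f := fun F : Finset (Fin s) => ∏ j ∈ F, n j)
    (fun _ _ => Nat.zero_le _) ?_
  simp only [Finset.mem_filter, Finset.powerset_univ, Finset.mem_univ, true_and]
  refine ⟨?_, h2, h3⟩
  have h4 := Finset.card_union_le F (Iset q s)
  have h5 : (Iset q s).card ≤ q := by
    unfold Iset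
    rw [Fin.card_filter_val_lt]
    exact min_le_right _ _
  omega

theorem Afun_zero (c q s : ℕ) (n : Fin s → ℕ) (h : (supp n ∪ Iset q s).card < c) :
    Afun c q s n = 0 := by
  unfold Afun
  refine Finset.sum_eq_zero ?_
  intro F hF
  simp only [Finset.mem_filter, Finset.powerset_univ, Finset.mem_univ, true_and] at hF
  by_contra hne
  rw [← ne_eq, Finset.prod_ne_zero_iff] at hne
  have hsub : F ⊆ supp n := fun j hj => by simp [supp, hne j hj]
  have h4 := Finset.card_le_card (Finset.union_subset_union_left (t := Iset q s) hsub)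
  have h5 := hF.2.2
  unfold Iset at h4 h
  omega

theorem le_prod_nat {s : ℕ} (n : Fin s → ℕ) (F : Finset (Fin s)) (h : ∀ j ∈ F, n j ≠ 0)
    (j : Fin s) (hj : j ∈ F) : n j ≤ ∏ j ∈ F, n j :=
  Nat.le_of_dvd (Nat.pos_of_ne_zero (Finset.prod_ne_zero_iff.mpr h)) (Finset.dvd_prod_of_mem _ hj)

/-- coordinates that are at least `M` -/
def Lset {s : ℕ} (M : ℕ) (n : Fin s → ℕ) : Finset (Fin s) := Finset.univ.filter fun j => M ≤ n j

theorem A_case2 (c q s M : ℕ) (hM : 1 ≤ M) (n : Fin s → ℕ)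
    (hbad : c ≤ (supp n ∪ Iset q s).card) (hL : (Lset M n).card + 1 = c) (j : Fin s)
    (hj : j ∈ Lset M n) : n j ≤ Afun c q s n := by
  have hLs : Lset M n ⊆ supp n := by
    intro i hi
    simp only [Lset, supp, Finset.mem_filter, Finset.mem_univ, true_and] at hi ⊢
    omega
  by_cases hc : c ≤ (Lset M n ∪ Iset q s).card
  · refine le_trans ?_ (Afun_ge c q s n (Lset M n) (by omega) hc)
    refine le_prod_nat n _ (fun i hi => ?_) j hj
    have := hLs hi
    simpa [supp] using this
  · have : ∃ x ∈ supp n ∪ Iset q s, x ∉ Lset M n ∪ Iset q s := by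
      by_contra hcon
      push Not at hcon
      have := Finset.card_le_card (show supp n ∪ Iset q s ⊆ Lset M n ∪ Iset q s from hcon)
      omega
    obtain ⟨x, hx, hx'⟩ := this
    simp only [Finset.mem_union, not_or] at hx hx'
    have hxs : x ∈ supp n := by tauto
    have hcard : (insert x (Lset M n)).card = c := by
      rw [Finset.card_insert_of_notMem hx'.1]; exact hL
    refine le_trans ?_ (Afun_ge c q s n (insert x (Lset M n)) hcard.le
      (hcard.symm.le.trans (Finset.card_le_card Finset.subset_union_left)))
    refine le_prod_nat n _ (fun i hi => ?_) j (Finset.mem_insert_of_mem hj)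
    have : i ∈ supp n := by
      rcases Finset.mem_insert.mp hi with rfl | h
      · exact hxs
      · exact hLs h
    simpa [supp] using this

theorem A_case3 (c q s M : ℕ) (hc2 : 2 ≤ c) (hM : 1 ≤ M) (n : Fin s → ℕ)
    (hL : c ≤ (Lset M n).card) (j : Fin s)
    (hj : j ∈ Lset M n) : M * n j ≤ Afun c q s n := by
  obtain ⟨F, hF1, hF2, hF3⟩ := Finset.exists_subsuperset_card_eq
    (Finset.singleton_subset_iff.mpr hj) (by simp; omega) hL
  have hjF : j ∈ F := Finset.singleton_subset_iff.mp hF1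
  have hMn : ∀ i ∈ F, M ≤ n i := fun i hi => by simpa [Lset] using hF2 hi
  refine le_trans ?_ (Afun_ge c q s n F hF3.le
      (hF3.symm.le.trans (Finset.card_le_card Finset.subset_union_left)))
  rw [← Finset.mul_prod_erase F n hjF, mul_comm]
  refine Nat.mul_le_mul_left _ ?_
  have : (F.erase j).Nonempty := by
    rw [← Finset.card_pos, Finset.card_erase_of_mem hjF]; omega
  obtain ⟨i, hi⟩ := this
  refine (hMn i (Finset.mem_of_mem_erase hi)).trans (le_prod_nat n _ (fun k hk => ?_) i hi)
  have := hMn k (Finset.mem_of_mem_erase hk)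
  omega

theorem lin_bound {s : ℕ} (L : Finset (Fin s)) (n : Fin s → ℕ) (κ m A : ℝ) (hκ : 0 ≤ κ)
    (hs : 0 < s) (hA : 0 ≤ A)
    (h : ∀ j ∈ L, m * n j ≤ A) :
    Real.exp (-κ * A) ≤ ∏ j ∈ L, Real.exp (-(κ * m / s)) ^ (n j) := by
  simp_rw [← Real.exp_nat_mul]
  rw [← Real.exp_sum]
  refine Real.exp_le_exp.mpr ?_
  have h1 : ∑ j ∈ L, m * n j ≤ s * A := by
    refine (Finset.sum_le_card_nsmul L _ A h).trans ?_
    rw [nsmul_eq_mul]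
    have : (L.card : ℝ) ≤ s := by
      have := Finset.card_le_univ L
      simp only [Fintype.card_fin] at this
      exact_mod_cast this
    gcongr
  have h2 : ∑ j ∈ L, (n j : ℝ) * -(κ * m / s) = -(κ / s) * ∑ j ∈ L, m * n j := by
    rw [Finset.mul_sum]
    exact Finset.sum_congr rfl fun j _ => by ring
  rw [h2]
  have hs' : (0:ℝ) < s := by exact_mod_cast hs
  have h3 : κ / s * ∑ j ∈ L, m * n j ≤ κ / s * (s * A) := by gcongr
  have h4 : κ / s * (s * A) = κ * A := by field_simp
  linarith

/-- The weight attached to each coordinate. -/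
noncomputable def ufun (c s M : ℕ) (κ : ℝ) (k : ℕ) : ℝ :=
  if k + 2 ≤ c then 1 else if k + 1 = c then Real.exp (-(κ * 1 / s))
    else Real.exp (-(κ * M / s))

theorem ufun_pos (c s M : ℕ) (κ : ℝ) (k : ℕ) : 0 < ufun c s M κ k := by
  unfold ufun
  split_ifs <;> positivity

theorem pointwise (c q s M : ℕ) (hc2 : 2 ≤ c) (hsc : c ≤ s) (hM : 1 ≤ M) (κ z : ℝ) (hκ : 0 < κ)
    (hz : 0 < z) (hz1 : z ≤ 1) (n : Fin s → ℕ) (hbad : c ≤ (supp n ∪ Iset q s).card) :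
    Real.exp (-κ * Afun c q s n) ≤ (z ^ (s * M))⁻¹ *
      ∏ j, (if j ∈ Lset M n then ufun c s M κ (Lset M n).card else z) ^ (n j) := by
  have h1 : Real.exp (-κ * Afun c q s n) ≤
      ∏ j ∈ Lset M n, ufun c s M κ (Lset M n).card ^ (n j) := by
    unfold ufun
    split_ifs with ha hb
    · simp only [one_pow, Finset.prod_const_one, Real.exp_le_one_iff]
      have : 0 ≤ κ * (Afun c q s n : ℝ) := by positivity
      linarith
    · refine lin_bound _ _ _ _ _ hκ.le (by omega) (by positivity) fun j hj => ?_
      rw [one_mul]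
      exact_mod_cast A_case2 c q s M hM n hbad hb j hj
    · refine lin_bound _ _ _ _ _ hκ.le (by omega) (by positivity) fun j hj => ?_
      exact_mod_cast A_case3 c q s M hc2 hM n (by omega) j hj
  have h2 : z ^ (s * M) ≤ ∏ j ∈ (Lset M n)ᶜ, z ^ (n j) := by
    rw [Finset.prod_pow_eq_pow_sum]
    refine pow_le_pow_of_le_one hz.le hz1 ?_
    have h := Finset.sum_le_card_nsmul (Lset M n)ᶜ n M (fun j hj => by
      simp [Lset] at hj; omega)
    have h' := Finset.card_le_univ (Lset M n)ᶜ
    simp only [Fintype.card_fin] at h'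
    refine h.trans ?_
    rw [smul_eq_mul]
    exact Nat.mul_le_mul_right _ h'
  have h3 : ∏ j, (if j ∈ Lset M n then ufun c s M κ (Lset M n).card else z) ^ (n j)
      = (∏ j ∈ Lset M n, ufun c s M κ (Lset M n).card ^ (n j)) *
        ∏ j ∈ (Lset M n)ᶜ, z ^ (n j) := by
    rw [← Finset.prod_mul_prod_compl (Lset M n)]
    congr 1
    · exact Finset.prod_congr rfl fun j hj => by rw [if_pos hj]
    · exact Finset.prod_congr rfl fun j hj => by rw [if_neg (Finset.mem_compl.mp hj)]
  rw [h3, ← div_eq_inv_mul, le_div_iff₀ (by positivity)]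
  refine mul_le_mul h1 h2 (by positivity) ?_
  exact Finset.prod_nonneg fun j _ => (pow_pos (ufun_pos _ _ _ _ _) _).le

theorem sum_y (c s : ℕ) (hc2 : 2 ≤ c) (hsc : c ≤ s) (κ : ℝ) (hκ : 0 < κ) :
    ∃ M : ℕ, 1 ≤ M ∧ ∃ z : ℝ, 0 < z ∧ z ≤ 1 ∧ ∃ S : ℝ, 0 < S ∧ S ≤ 1 ∧ ∀ L : Finset (Fin s),
      ∑ j, (if j ∈ L then ufun c s M κ L.card else z) ≤ c - 1 - S := by
  have hs : (0:ℝ) < s := by exact_mod_cast (by omega : 0 < s)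
  have hs1 : (1:ℝ) ≤ s := by exact_mod_cast (by omega : 1 ≤ s)
  have hc : (2:ℝ) ≤ c := by exact_mod_cast hc2
  set e := Real.exp (-(κ * 1 / s)) with he
  have he0 : 0 < e := Real.exp_pos _
  have he1 : e < 1 := by
    rw [he, Real.exp_lt_one_iff]
    have : 0 < κ * 1 / s := by positivity
    linarith
  set z := (1 - e) / (2 * s) with hz
  have hz0 : 0 < z := by
    have : 0 < 1 - e := by linarith
    positivity
  have hsz : s * z = (1 - e) / 2 := by rw [hz]; field_simp
  have hz1 : z ≤ 1 := by nlinarith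
  obtain ⟨M, hM⟩ := exists_pow_lt_of_lt_one hz0 he1
  have hM1 : 1 ≤ M := by
    rcases Nat.eq_zero_or_pos M with rfl | h
    · simp at hM; linarith
    · exact h
  have hM2 : Real.exp (-(κ * M / s)) ≤ z := by
    rw [he, ← Real.exp_nat_mul] at hM
    refine le_trans (le_of_eq ?_) hM.le
    congr 1; ring
  refine ⟨M, hM1, z, hz0, hz1, (1 - e) / 2, by linarith, by linarith, fun L => ?_⟩
  by_cases hL : c ≤ L.card
  · have : ∑ j, (if j ∈ L then ufun c s M κ L.card else z) ≤ ∑ j : Fin s, z := by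
      refine Finset.sum_le_sum fun j _ => ?_
      split_ifs
      · unfold ufun
        rw [if_neg (by omega), if_neg (by omega)]
        exact hM2
      · exact le_rfl
    simp only [Finset.sum_const, Finset.card_univ, Fintype.card_fin, nsmul_eq_mul] at this
    linarith
  · have hle : ∑ j, (if j ∈ L then ufun c s M κ L.card else z) ≤ 
        ∑ j : Fin s, ((if j ∈ L then ufun c s M κ L.card else 0) + z) := by
      refine Finset.sum_le_sum fun j _ => ?_
      split_ifs
      · linarith
      · linarith
    rw [Finset.sum_add_distrib] at hle
    simp only [Finset.sum_const, Finset.card_univ, Fintype.card_fin, nsmul_eq_mul,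
      Finset.sum_ite_mem, Finset.univ_inter] at hle
    have : (L.card : ℝ) * ufun c s M κ L.card ≤ c - 1 - (1 - e) := by
      unfold ufun
      split_ifs with h1 h2
      · have : (L.card : ℝ) + 2 ≤ c := by exact_mod_cast h1
        linarith
      · have : (L.card : ℝ) + 1 = c := by exact_mod_cast h2
        rw [← he]
        nlinarith
      · omega
    linarith

/-- the Poisson-type weight -/
noncomputable def wfun {s : ℕ} (a : ℝ) (n : Fin s → ℕ) : ℝ :=
  ∏ j, (a ^ (n j) / (Nat.factorial (n j) : ℝ))

theorem hasSum_exp_real (x : ℝ) : HasSum (fun n : ℕ => x ^ n / (Nat.factorial n : ℝ)) (Real.exp x) := by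
  rw [Real.exp_eq_exp_ℝ]
  exact NormedSpace.expSeries_div_hasSum_exp x

theorem hasSum_w (s : ℕ) (a : ℝ) (ha : 0 < a) (y : Fin s → ℝ) (hy : ∀ j, 0 < y j) :
    HasSum (fun n : Fin s → ℕ => wfun a n * ∏ j, y j ^ (n j)) (Real.exp (a * ∑ j, y j)) := by
  have h := hasSum_pi_prod s (fun j n => (a * y j) ^ n / (Nat.factorial n : ℝ))
    (fun j => Real.exp (a * y j)) (fun j n => by have := hy j; positivity)
    (fun j => hasSum_exp_real _)
  rw [← Real.exp_sum, ← Finset.mul_sum] at h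
  refine h.congr_fun ?_
  intro n
  rw [wfun, ← Finset.prod_mul_distrib]
  refine Finset.prod_congr rfl fun j _ => ?_
  rw [mul_pow]; ring

theorem hasSum_supp (s : ℕ) (a : ℝ) (ha : 0 < a) (T : Finset (Fin s)) :
    HasSum (fun n : Fin s → ℕ => if supp n = T then wfun a n else 0)
      ((Real.exp a - 1) ^ T.card) := by
  have h := hasSum_pi_prod s
    (fun j n => if j ∈ T then (if n = 0 then 0 else a ^ n / (Nat.factorial n : ℝ))
      else (if n = 0 then 1 else 0))
    (fun j => if j ∈ T then Real.exp a - 1 else 1)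
    (fun j n => by split_ifs <;> positivity)
    (fun j => by
      split_ifs
      · have h1 := (hasSum_exp_real a).sub (hasSum_ite_eq (0:ℕ) (1:ℝ))
        refine h1.congr_fun ?_
        intro n
        by_cases hn : n = 0
        · simp [hn]
        · simp [hn]
      · exact hasSum_ite_eq (0:ℕ) (1:ℝ))
  have hp : ∏ j, (if j ∈ T then Real.exp a - 1 else 1) = (Real.exp a - 1) ^ T.card := by
    simp [Finset.prod_ite_mem]
  rw [hp] at h
  refine h.congr_fun ?_
  intro n
  by_cases hT : supp n = T
  · rw [if_pos hT, wfun]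
    refine Finset.prod_congr rfl fun j _ => ?_
    have : j ∈ T ↔ n j ≠ 0 := by rw [← hT]; simp [supp]
    by_cases hj : n j = 0
    · simp [this, hj]
    · simp [this, hj]
  · rw [if_neg hT]
    symm
    rw [Finset.prod_eq_zero_iff]
    by_contra hcon
    push Not at hcon
    apply hT
    ext j
    have := hcon j (Finset.mem_univ _)
    by_cases hj : n j = 0 <;> by_cases hjT : j ∈ T <;> simp_all [supp]

/-- supports on which `A` vanishes -/
def Good (c q s : ℕ) : Finset (Finset (Fin s)) :=
  Finset.univ.filter fun T => (T ∪ Iset q s).card < c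

theorem card_top (c q s : ℕ) (hc2 : 2 ≤ c) (hsc : c ≤ s) (hqc : q ≤ c) :
    ((Good c q s).filter fun T => T.card + 1 = c).card = Nat.choose (s - q) (s - c + 1) := by
  have hI : (Iset q s)ᶜ.card = s - q := by
    rw [Finset.card_compl, Fintype.card_fin]
    unfold Iset
    rw [Fin.card_filter_val_lt, min_eq_right (by omega)]
  rw [← hI, ← Finset.card_powersetCard]
  refine Finset.card_nbij' (fun T => Tᶜ) (fun T => Tᶜ) ?_ ?_ ?_ ?_
  · intro T hT
    simp only [Good, Finset.coe_filter, Finset.mem_filter, Finset.mem_univ, true_and,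
      Set.mem_ofPred_eq] at hT
    simp only [Finset.mem_coe, Finset.mem_powersetCard, Finset.card_compl, Fintype.card_fin]
    refine ⟨?_, by omega⟩
    rw [Finset.compl_subset_compl]
    have : T = T ∪ Iset q s := Finset.eq_of_subset_of_card_le Finset.subset_union_left (by omega)
    rw [this]
    exact Finset.subset_union_right
  · intro T hT
    simp only [Finset.mem_coe, Finset.mem_powersetCard] at hT
    simp only [Good, Finset.coe_filter, Finset.mem_filter, Finset.mem_univ, true_and,
      Set.mem_ofPred_eq]
    have h1 : Iset q s ⊆ Tᶜ := by
      rw [Finset.subset_compl_comm]; exact hT.1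
    rw [Finset.union_eq_left.mpr h1, Finset.card_compl, Fintype.card_fin]
    omega
  · intro T _; simp
  · intro T _; simp

theorem term_bound (c k : ℕ) (hc2 : 2 ≤ c) (hk : k + 1 ≤ c) (a : ℝ) (ha : 0 < a) :
    |(Real.exp a - 1) ^ k * Real.exp (-(a * (c - 1))) - (if k + 1 = c then 1 else 0)|
      ≤ c * Real.exp (-a) := by
  have hc : (2:ℝ) ≤ c := by exact_mod_cast hc2
  have he1 : 1 ≤ Real.exp a := Real.one_le_exp ha.le
  have hx0 : 0 < Real.exp (-a) := Real.exp_pos _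
  have hx1 : Real.exp (-a) ≤ 1 := Real.exp_le_one_iff.mpr (by linarith)
  have key : (Real.exp a - 1) ^ k * Real.exp (-(a * k)) = (1 - Real.exp (-a)) ^ k := by
    have : Real.exp (-(a * k)) = Real.exp (-a) ^ k := by
      rw [← Real.exp_nat_mul]; congr 1; ring
    rw [this, ← mul_pow, sub_mul, ← Real.exp_add]; simp
  have hp1 : (1 - Real.exp (-a)) ^ k ≤ 1 := pow_le_one₀ (by linarith) (by linarith)
  have hp0 : 0 ≤ (1 - Real.exp (-a)) ^ k := pow_nonneg (by linarith) _
  split_ifs with h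
  · have hck : (c : ℝ) - 1 = k := by rw [← h]; push_cast; ring
    rw [hck, key, abs_le]
    have := one_add_mul_le_pow (a := -Real.exp (-a)) (by linarith) k
    rw [← sub_eq_add_neg] at this
    have hk' : (k:ℝ) + 1 = c := by linarith
    constructor <;> nlinarith
  · have h2 : (k:ℝ) + 2 ≤ c := by exact_mod_cast (by omega : k + 2 ≤ c)
    have h3 : Real.exp (-(a * (c - 1))) ≤ Real.exp (-(a * k)) * Real.exp (-a) := by
      rw [← Real.exp_add]
      refine Real.exp_le_exp.mpr ?_
      nlinarith
    have h4 : 0 ≤ (Real.exp a - 1) ^ k := pow_nonneg (by linarith) _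
    rw [sub_zero, abs_of_nonneg (by positivity)]
    calc _ ≤ (Real.exp a - 1) ^ k * (Real.exp (-(a * k)) * Real.exp (-a)) := by gcongr
      _ = (1 - Real.exp (-a)) ^ k * Real.exp (-a) := by rw [← key]; ring
      _ ≤ c * Real.exp (-a) := by gcongr; linarith

theorem good_bound (c q s : ℕ) (hc2 : 2 ≤ c) (hsc : c ≤ s) (hqc : q ≤ c) (a : ℝ) (ha : 0 < a) :
    |(∑ T ∈ Good c q s, (Real.exp a - 1) ^ T.card) * Real.exp (-(a * (c - 1)))
      - (Nat.choose (s - q) (s - c + 1) : ℝ)| ≤ 2 ^ s * c * Real.exp (-a) := by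
  rw [← card_top c q s hc2 hsc hqc, Finset.card_filter, Finset.sum_mul]
  push_cast
  rw [← Finset.sum_sub_distrib]
  refine (Finset.abs_sum_le_sum_abs _ _).trans ?_
  refine (Finset.sum_le_card_nsmul _ _ (c * Real.exp (-a)) fun T hT => ?_).trans ?_
  · refine term_bound c T.card hc2 ?_ a ha
    simp only [Good, Finset.mem_filter, Finset.mem_univ, true_and] at hT
    have := Finset.card_le_card (Finset.subset_union_left (s₁ := T) (s₂ := Iset q s))
    omega
  · rw [nsmul_eq_mul, mul_assoc]
    have : (Good c q s).card ≤ 2 ^ s := by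
      refine (Finset.card_le_univ _).trans ?_
      simp
    have : ((Good c q s).card : ℝ) ≤ 2 ^ s := by exact_mod_cast this
    gcongr

theorem wfun_nonneg {s : ℕ} (a : ℝ) (ha : 0 < a) (n : Fin s → ℕ) : 0 ≤ wfun a n := by
  unfold wfun; positivity

/-- The exponential-rate convergence (cvg) from the proof of Lemma 1. -/
theorem stmt6 (d c s q : ℕ) (hc2 : 2 ≤ c) (hcd : c ≤ d) (hsc : c ≤ s) (hqc : q ≤ c)
    (Q ν : ℝ) (hQ : 0 < Q) (hν : ν < 0) :
    ∃ R > (0 : ℝ), ∃ S > (0 : ℝ), ∀ a > (0 : ℝ),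
      |Bfun d c ν Q a q s - (Nat.choose (s - q) (s - c + 1) : ℝ)|
        < R * Real.exp (-S * a) := by
  obtain ⟨κ, hκdef⟩ : ∃ κ : ℝ, κ = -(ν * Q ^ (d - c)) := ⟨_, rfl⟩
  have hκ : 0 < κ := by
    have : 0 < Q ^ (d - c) := by positivity
    rw [hκdef]; nlinarith
  obtain ⟨M, hM, z, hz, hz1, S, hS, hS1, hsum⟩ := sum_y c s hc2 hsc κ hκ
  obtain ⟨C, hCdef⟩ : ∃ C : ℝ, C = (z ^ (s * M))⁻¹ := ⟨_, rfl⟩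
  have hC : 0 < C := by rw [hCdef]; positivity
  refine ⟨C * 2 ^ s + 2 ^ s * c + 1, by positivity, S, hS, fun a ha => ?_⟩
  -- the good part
  have hgood : HasSum (fun n : Fin s → ℕ => ∑ T ∈ Good c q s, if supp n = T then wfun a n else 0)
      (∑ T ∈ Good c q s, (Real.exp a - 1) ^ T.card) :=
    hasSum_sum fun T _ => hasSum_supp s a ha T
  have hgood' : ∀ n : Fin s → ℕ, (∑ T ∈ Good c q s, if supp n = T then wfun a n else 0)
      = if (supp n ∪ Iset q s).card < c then wfun a n else 0 := by
    intro n
    rw [Finset.sum_ite_eq]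
    simp [Good]
  simp_rw [hgood'] at hgood
  -- the dominating series
  let y : Finset (Fin s) → Fin s → ℝ := fun L j => if j ∈ L then ufun c s M κ L.card else z
  have hy : ∀ L j, 0 < y L j := by
    intro L j
    simp only [y]
    split_ifs
    · exact ufun_pos _ _ _ _ _
    · exact hz
  have hdom : HasSum (fun n : Fin s → ℕ => C * ∑ L : Finset (Fin s), wfun a n * ∏ j, y L j ^ (n j))
      (C * ∑ L : Finset (Fin s), Real.exp (a * ∑ j, y L j)) :=
    (hasSum_sum fun L _ => hasSum_w s a ha (y L) (hy L)).mul_left C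
  let b : (Fin s → ℕ) → ℝ := fun n =>
    if (supp n ∪ Iset q s).card < c then 0 else wfun a n * Real.exp (-κ * Afun c q s n)
  have hb0 : ∀ n, 0 ≤ b n := by
    intro n
    have := wfun_nonneg a ha n
    simp only [b]
    split_ifs <;> positivity
  have hterm0 : ∀ (n : Fin s → ℕ) L, 0 ≤ wfun a n * ∏ j, y L j ^ (n j) := fun n L =>
    mul_nonneg (wfun_nonneg a ha n) (Finset.prod_nonneg fun j _ => (pow_pos (hy L j) _).le)
  have hble : ∀ n, b n ≤ C * ∑ L : Finset (Fin s), wfun a n * ∏ j, y L j ^ (n j) := by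
    intro n
    simp only [b]
    split_ifs with h
    · exact mul_nonneg hC.le (Finset.sum_nonneg fun L _ => hterm0 n L)
    · have h1 := pointwise c q s M hc2 hsc hM κ z hκ hz hz1 n (by omega)
      rw [← hCdef] at h1
      have h2 := Finset.single_le_sum (f := fun L => wfun a n * ∏ j, y L j ^ (n j))
        (fun L _ => hterm0 n L) (Finset.mem_univ (Lset M n))
      calc _ ≤ wfun a n * (C * ∏ j, y (Lset M n) j ^ (n j)) :=
            mul_le_mul_of_nonneg_left h1 (wfun_nonneg a ha n)
        _ = C * (wfun a n * ∏ j, y (Lset M n) j ^ (n j)) := by ring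
        _ ≤ _ := mul_le_mul_of_nonneg_left h2 hC.le
  have hbs : Summable b := Summable.of_nonneg_of_le hb0 hble hdom.summable
  obtain ⟨E, hE⟩ := hbs
  have hE0 : 0 ≤ E := hE.nonneg hb0
  have hE1 : E ≤ C * 2 ^ s * Real.exp (a * (c - 1 - S)) := by
    refine (hasSum_le hble hE hdom).trans ?_
    rw [mul_assoc]
    refine mul_le_mul_of_nonneg_left ?_ hC.le
    refine (Finset.sum_le_card_nsmul _ _ (Real.exp (a * (c - 1 - S))) fun L _ => ?_).trans ?_
    · refine Real.exp_le_exp.mpr (mul_le_mul_of_nonneg_left (hsum L) ha.le)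
    · simp
  have hB : Bfun d c ν Q a q s = (∑ T ∈ Good c q s, (Real.exp a - 1) ^ T.card)
      * Real.exp (-(a * (c - 1))) + E * Real.exp (-(a * (c - 1))) := by
    unfold Bfun
    rw [← add_mul]
    refine HasSum.tsum_eq ?_
    refine ((hgood.add hE).mul_right (Real.exp (-(a * (c - 1))))).congr_fun ?_
    intro n
    have hw : a ^ (∑ i, n i) / ∏ i, (Nat.factorial (n i) : ℝ) = wfun a n := by
      rw [wfun, Finset.prod_div_distrib, Finset.prod_pow_eq_pow_sum]
    have hν' : ν * Q ^ (d - c) = -κ := by rw [hκdef]; ring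
    rw [hw, hν', sub_eq_add_neg, Real.exp_add, ← mul_assoc]
    congr 1
    simp only [b]
    split_ifs with h
    · rw [Afun_zero c q s n h]; simp
    · simp
  have hEe : E * Real.exp (-(a * (c - 1))) ≤ C * 2 ^ s * Real.exp (-S * a) := by
    refine (mul_le_mul_of_nonneg_right hE1 (Real.exp_pos _).le).trans (le_of_eq ?_)
    rw [mul_assoc, ← Real.exp_add]
    congr 2; ring
  have hg := good_bound c q s hc2 hsc hqc a ha
  have hexp : Real.exp (-a) ≤ Real.exp (-S * a) := Real.exp_le_exp.mpr (by nlinarith)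
  have hg2 : 2 ^ s * c * Real.exp (-a) ≤ 2 ^ s * c * Real.exp (-S * a) := by gcongr
  have hEpos : 0 ≤ E * Real.exp (-(a * (c - 1))) := by positivity
  have hpos := Real.exp_pos (-S * a)
  rw [hB, add_sub_right_comm]
  refine (abs_add_le _ _).trans_lt ?_
  rw [abs_of_nonneg hEpos]
  linarith
end
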